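/- arXiv:0806.0280 — 2 statements merged into one kernel-verified Lean document; each statement's English description precedes it below -/
import Mathlib

section
/- τ_E(NC²_n) = n²/8 + Θ(n); that is, there exist constants c₁ > 0, c₂ > 0 and n₀ such that for all n ≥ n₀, c₁·n ≤ τ_E(NC²_n) − n²/8 ≤ c₂·n. -/
/-- An edge of the complete graph `K_n` on vertex set `Fin n`:
a non-diagonal element of `Sym2 (Fin n)`. -/
abbrev Edge (n : ℕ) := {e : Sym2 (Fin n) // ¬ e.IsDiag}

/-- A position in the game: the pair (edges claimed by Avoider, edges claimed by Enforcer). -/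
abbrev Position (n : ℕ) := Finset (Edge n) × Finset (Edge n)

/-- A strategy assigns to each position an edge to claim. -/
abbrev Strategy (n : ℕ) := Position n → Edge n

/-- A strategy is legal if, whenever some edge is still unclaimed,
it selects a previously unclaimed edge. -/
def Legal (n : ℕ) (s : Strategy n) : Prop :=
  ∀ p : Position n, p.1 ∪ p.2 ≠ Finset.univ → s p ∉ p.1 ∪ p.2

/-- The position after `t` full rounds, Avoider moving first in each round. -/
def play (n : ℕ) (sA sE : Strategy n) : ℕ → Position n
  | 0 => (∅, ∅)
  | t + 1 =>
    let p := play n sA sE t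
    let a : Finset (Edge n) := insert (sA p) p.1
    (a, insert (sE (a, p.2)) p.2)

/-- Enforcer can force Avoider's claimed edge set to contain a losing set of `F`
by the end of Avoider's `t`-th move. -/
def EnforcerWinsBy (n : ℕ) (F : Set (Finset (Edge n))) (t : ℕ) : Prop :=
  ∃ sE : Strategy n, Legal n sE ∧ ∀ sA : Strategy n, Legal n sA →
    ∃ L ∈ F, L ⊆ (play n sA sE t).1

/-- The minimum number of moves Enforcer needs to win the Avoider–Enforcer game on `F`;
`⊤` if Enforcer cannot win. -/
noncomputable def tauE (n : ℕ) (F : Set (Finset (Edge n))) : ℕ∞ :=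
  sInf ((fun t : ℕ => (t : ℕ∞)) '' {t : ℕ | EnforcerWinsBy n F t})

/-- The simple graph on `Fin n` whose edges are the elements of `E`. -/
def toGraph (n : ℕ) (E : Finset (Edge n)) : SimpleGraph (Fin n) :=
  SimpleGraph.fromEdgeSet (Subtype.val '' (E : Set (Edge n)))

/-- `NC²_n`: the family of edge sets of non-bipartite (non-2-colorable) graphs on `Fin n`. -/
def NC2 (n : ℕ) : Set (Finset (Edge n)) :=
  {E | ¬ (toGraph n E).Colorable 2}

/-- The edges whose endpoints receive distinct colours under `c`. -/
def bichromatic {n : ℕ} (c : Fin n → Bool) : Finset (Edge n) :=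
  Finset.univ.filter fun e => ¬ (e.1.map c).IsDiag

/-- The edges that are bichromatic under every proper 2-colouring of `E`. -/
def forcedEdges {n : ℕ} (E : Finset (Edge n)) : Finset (Edge n) :=
  Finset.univ.filter fun e => ∀ c : Fin n → Bool, E ⊆ bichromatic c → e ∈ bichromatic c

/-- The proper 2-colourings of `E`. -/
def properColorings {n : ℕ} (E : Finset (Edge n)) : Finset (Fin n → Bool) :=
  Finset.univ.filter fun c => E ⊆ bichromatic c

/-- Claim a free edge of `Q` if there is one, and any free edge otherwise. -/
noncomputable def greedy {n : ℕ} [Inhabited (Edge n)] (Q : Finset (Edge n)) (p : Position n) :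
    Edge n :=
  if h : (Q \ (p.1 ∪ p.2)).Nonempty then h.choose
  else if h : ((p.1 ∪ p.2)ᶜ).Nonempty then h.choose
  else default

/-- The edges containing the vertex `v`. -/
def edgesAt {n : ℕ} (v : Fin n) : Finset (Edge n) :=
  Finset.univ.filter fun e => v ∈ e.1

section Coloring

variable {n : ℕ}

theorem mem_bichromatic {c : Fin n → Bool} {u v : Fin n} (h : ¬ (s(u, v)).IsDiag) :
    (⟨s(u, v), h⟩ : Edge n) ∈ bichromatic c ↔ c u ≠ c v := by
  simp [bichromatic]

theorem colorable_iff (E : Finset (Edge n)) :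
    (toGraph n E).Colorable 2 ↔ ∃ c : Fin n → Bool, E ⊆ bichromatic c := by
  constructor
  · intro h
    have C : (toGraph n E).Coloring Bool := h.toColoring (by simp)
    refine ⟨C, ?_⟩
    rintro ⟨e, he⟩ heE
    induction e with
    | _ u v =>
      rw [mem_bichromatic]
      apply C.valid
      rw [toGraph, SimpleGraph.fromEdgeSet_adj]
      exact ⟨⟨_, heE, rfl⟩, by simpa using he⟩
  · rintro ⟨c, hc⟩
    have C : (toGraph n E).Coloring Bool := SimpleGraph.Coloring.mk c (by
      intro u v huv
      rw [toGraph, SimpleGraph.fromEdgeSet_adj] at huv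
      obtain ⟨⟨⟨e, he⟩, heE, rfl⟩, -⟩ := huv
      exact (mem_bichromatic he).1 (hc heE))
    simpa using C.colorable

theorem card_bichromatic (A : Finset (Fin n)) :
    (bichromatic fun x => decide (x ∈ A)).card = A.card * (n - A.card) := by
  have h : (bichromatic fun x => decide (x ∈ A)).map ⟨Subtype.val, Subtype.val_injective⟩ =
      (A ×ˢ Aᶜ).image fun p => s(p.1, p.2) := by
    ext e
    induction e with
    | _ u v =>
      simp only [Finset.mem_map, Finset.mem_image, Function.Embedding.coeFn_mk, Prod.exists,
        Finset.mem_product, Finset.mem_compl, bichromatic, Finset.mem_filter, Finset.mem_univ,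
        true_and, Subtype.exists, exists_and_right, exists_eq_right]
      constructor
      · rintro ⟨he, h⟩
        simp only [Sym2.map_mk, Sym2.mk_isDiag_iff, decide_eq_decide] at h
        by_cases hu : u ∈ A
        · exact ⟨u, v, ⟨hu, by tauto⟩, rfl⟩
        · exact ⟨v, u, ⟨by tauto, hu⟩, Sym2.eq_swap⟩
      · rintro ⟨x, y, ⟨hx, hy⟩, h⟩
        rw [← h]
        refine ⟨?_, ?_⟩
        · rintro h'
          rw [Sym2.mk_isDiag_iff] at h'
          exact hy (h' ▸ hx)
        · simp [hx, hy]
  rw [← Finset.card_map, h, Finset.card_image_of_injOn, Finset.card_product, Finset.card_compl,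
    Fintype.card_fin]
  rintro ⟨x, y⟩ hxy ⟨z, w⟩ hzw h
  simp only [Finset.coe_product, Set.mem_prod, Finset.mem_coe, Finset.mem_compl] at hxy hzw
  simp only [Sym2.eq_iff] at h
  rcases h with ⟨rfl, rfl⟩ | ⟨rfl, rfl⟩
  · rfl
  · exact absurd hxy.1 hzw.2

theorem four_mul_card_bichromatic_le (c : Fin n → Bool) : 4 * (bichromatic c).card ≤ n ^ 2 := by
  have h := card_bichromatic (Finset.univ.filter fun x => c x = true)
  have hA : (Finset.univ.filter fun x => c x = true).card ≤ n := by
    simpa using Finset.card_le_univ (Finset.univ.filter fun x => c x = true)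
  simp only [Finset.mem_filter, Finset.mem_univ, true_and, Bool.decide_eq_true] at h
  rw [h]
  zify [hA]
  nlinarith [sq_nonneg ((n : ℤ) - 2 * (Finset.univ.filter fun x => c x = true).card)]

theorem subset_forcedEdges (E : Finset (Edge n)) : E ⊆ forcedEdges E := fun e he => by
  simpa [forcedEdges] using fun c hc => hc he

theorem forcedEdges_mono {E F : Finset (Edge n)} (h : E ⊆ F) :
    forcedEdges E ⊆ forcedEdges F := fun e he => by
  simp only [forcedEdges, Finset.mem_filter, Finset.mem_univ, true_and] at he ⊢
  exact fun c hc => he c (h.trans hc)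

theorem forcedEdges_subset {E : Finset (Edge n)} {c : Fin n → Bool} (h : E ⊆ bichromatic c) :
    forcedEdges E ⊆ bichromatic c := fun e he => by
  simp only [forcedEdges, Finset.mem_filter, Finset.mem_univ, true_and] at he
  exact he c h

theorem properColorings_anti {E F : Finset (Edge n)} (h : E ⊆ F) :
    properColorings F ⊆ properColorings E := fun c hc => by
  simp only [properColorings, Finset.mem_filter, Finset.mem_univ, true_and] at hc ⊢
  exact h.trans hc

theorem bichromatic_xor {c c₀ c₁ : Fin n → Bool} {e : Edge n}
    (h : e ∈ bichromatic c) (h₁ : e ∈ bichromatic c₁) :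
    e ∈ bichromatic (fun x => (c x ^^ c₀ x) ^^ c₁ x) ↔ e ∈ bichromatic c₀ := by
  obtain ⟨e, he⟩ := e
  induction e with
  | _ u v =>
    simp only [mem_bichromatic] at *
    revert h h₁
    generalize c u = a, c v = b, c₀ u = a₀, c₀ v = b₀, c₁ u = a₁, c₁ v = b₁
    revert a b a₀ b₀ a₁ b₁
    decide

/-- Adding an edge that is not forced at least halves the number of proper colourings. -/
theorem two_mul_card_properColorings_insert_le {E : Finset (Edge n)} {e : Edge n}
    (he : e ∉ forcedEdges E) :
    2 * (properColorings (insert e E)).card ≤ (properColorings E).card := by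
  rcases (properColorings (insert e E)).eq_empty_or_nonempty with h | ⟨c₁, h₁⟩
  · simp [h]
  simp only [forcedEdges, Finset.mem_filter, Finset.mem_univ, true_and, not_forall] at he
  obtain ⟨c₀, hc₀, he₀⟩ := he
  have hc₁ : insert e E ⊆ bichromatic c₁ := by simpa [properColorings] using h₁
  have hdisj : Disjoint (properColorings (insert e E))
      ((properColorings (insert e E)).image fun c x => (c x ^^ c₀ x) ^^ c₁ x) := by
    rw [Finset.disjoint_left]
    rintro d hd hd'
    obtain ⟨c, hc, rfl⟩ := Finset.mem_image.1 hd'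
    simp only [properColorings, Finset.mem_filter, Finset.mem_univ, true_and] at hd hc
    exact he₀ ((bichromatic_xor (hc (Finset.mem_insert_self _ _))
      (hc₁ (Finset.mem_insert_self _ _))).1 (hd (Finset.mem_insert_self _ _)))
  have hsub : properColorings (insert e E) ∪
      (properColorings (insert e E)).image (fun c x => (c x ^^ c₀ x) ^^ c₁ x) ⊆
      properColorings E := by
    apply Finset.union_subset (properColorings_anti (Finset.subset_insert _ _))
    intro d hd'
    obtain ⟨c, hc, rfl⟩ := Finset.mem_image.1 hd'
    simp only [properColorings, Finset.mem_filter, Finset.mem_univ, true_and] at hc ⊢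
    intro f hf
    exact (bichromatic_xor (hc (Finset.mem_insert_of_mem hf))
      (hc₁ (Finset.mem_insert_of_mem hf))).2 (hc₀ hf)
  have hinj : Function.Injective fun (c : Fin n → Bool) x => (c x ^^ c₀ x) ^^ c₁ x := by
    intro c d h
    funext x
    simpa using congrFun h x
  have := Finset.card_le_card hsub
  rw [Finset.card_union_of_disjoint hdisj, Finset.card_image_of_injective _ hinj] at this
  omega

end Coloring

section Play

variable {n : ℕ}

theorem play_fst_mono (sA sE : Strategy n) : Monotone fun t => (play n sA sE t).1 :=
  monotone_nat_of_le_succ fun _ => Finset.subset_insert _ _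

theorem card_edge : Fintype.card (Edge n) = n.choose 2 := by
  simpa using Sym2.card_subtype_not_diag (α := Fin n)

theorem sq_eq_two_mul_choose_two_add (n : ℕ) : n ^ 2 = 2 * n.choose 2 + n := by
  rw [Nat.choose_two_right, Nat.mul_div_cancel' (Nat.even_mul_pred_self n).two_dvd]
  cases n with
  | zero => rfl
  | succ m => rw [Nat.add_sub_cancel]; ring

theorem union_ne_univ {a b : Finset (Edge n)} (h : a.card + b.card < n.choose 2) :
    a ∪ b ≠ Finset.univ := by
  intro h'
  have := Finset.card_union_le a b
  rw [h', Finset.card_univ, card_edge] at this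
  omega

theorem play_card {sA sE : Strategy n} (hA : Legal n sA) (hE : Legal n sE) (t : ℕ)
    (ht : 2 * t ≤ n.choose 2) :
    (play n sA sE t).1.card = t ∧ (play n sA sE t).2.card = t ∧
      Disjoint (play n sA sE t).1 (play n sA sE t).2 := by
  induction t with
  | zero => simp [play]
  | succ t ih =>
    obtain ⟨h₁, h₂, h₃⟩ := ih (by omega)
    simp only [play]
    set p := play n sA sE t
    have ha := hA p (union_ne_univ (by omega))
    rw [Finset.mem_union, not_or] at ha
    have ha' : (insert (sA p) p.1).card = t + 1 := by rw [Finset.card_insert_of_notMem ha.1, h₁]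
    have hb := hE (insert (sA p) p.1, p.2) (union_ne_univ (by simp only; omega))
    rw [Finset.mem_union, not_or] at hb
    refine ⟨ha', by rw [Finset.card_insert_of_notMem hb.2, h₂], ?_⟩
    rw [Finset.disjoint_insert_right]
    exact ⟨hb.1, Finset.disjoint_insert_left.2 ⟨ha.2, h₃⟩⟩

variable [Inhabited (Edge n)]

theorem greedy_mem {Q : Finset (Edge n)} {p : Position n} (h : (Q \ (p.1 ∪ p.2)).Nonempty) :
    greedy Q p ∈ Q \ (p.1 ∪ p.2) := by
  rw [greedy, dif_pos h]
  exact h.choose_spec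

theorem greedy_legal (Q : Finset (Edge n)) (p : Position n) (hp : p.1 ∪ p.2 ≠ Finset.univ) :
    greedy Q p ∉ p.1 ∪ p.2 := by
  by_cases h : (Q \ (p.1 ∪ p.2)).Nonempty
  · exact (Finset.mem_sdiff.1 (greedy_mem h)).2
  · have h' : ((p.1 ∪ p.2)ᶜ).Nonempty := by
      rwa [Finset.nonempty_iff_ne_empty, Ne, Finset.compl_eq_empty_iff]
    rw [greedy, dif_neg h, dif_pos h']
    exact Finset.mem_compl.1 h'.choose_spec

end Play

section Enforcer

variable {n : ℕ} [Inhabited (Edge n)]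

/-- Enforcer claims forced edges as long as he can: the number `t` of rounds is bounded in terms of
the number of forced edges he has claimed and the number `m` of non-forced moves of Avoider. -/
theorem play_forced_greedy {sA : Strategy n} (hA : Legal n sA) (t : ℕ)
    (ht : 2 * t ≤ n.choose 2) :
    let p := play n sA (fun p => greedy (forcedEdges p.1) p) t
    ∃ m, 2 ^ m * (properColorings p.1).card ≤ 2 ^ n ∧
      (t ≤ (p.2 ∩ forcedEdges p.1).card + m ∨
        t = (p.2 ∩ forcedEdges p.1).card + m + 1 ∧ forcedEdges p.1 ⊆ p.1 ∪ p.2) := by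
  set sE : Strategy n := fun p => greedy (forcedEdges p.1) p
  have hE : Legal n sE := fun p => greedy_legal _ p
  induction t with
  | zero =>
    refine ⟨0, ?_, Or.inl (Nat.zero_le _)⟩
    simpa using Finset.card_le_univ (properColorings (play n sA sE 0).1)
  | succ t ih =>
    obtain ⟨m, hm, hx⟩ := ih (by omega)
    obtain ⟨h₁, h₂, -⟩ := play_card hA hE t (by omega)
    simp only [play]
    set p := play n sA sE t
    have ha := hA p (union_ne_univ (by omega))
    set a := insert (sA p) p.1
    have hsub : p.1 ⊆ a := Finset.subset_insert _ _
    have hmono := Finset.card_le_card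
      (Finset.inter_subset_inter (subset_refl p.2) (forcedEdges_mono hsub))
    have hpc := Finset.card_le_card (properColorings_anti hsub)
    obtain ⟨m', hm', hx'⟩ : ∃ m', 2 ^ m' * (properColorings a).card ≤ 2 ^ n ∧
        t ≤ (p.2 ∩ forcedEdges p.1).card + m' := by
      by_cases hf : sA p ∈ forcedEdges p.1
      · refine ⟨m, (Nat.mul_le_mul_left _ hpc).trans hm, ?_⟩
        rcases hx with hx | ⟨-, hx⟩
        · exact hx
        · exact absurd (hx hf) ha
      · refine ⟨m + 1, ?_, by omega⟩
        refine le_trans ?_ hm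
        rw [pow_succ, mul_assoc]
        exact Nat.mul_le_mul_left _ (two_mul_card_properColorings_insert_le hf)
    refine ⟨m', hm', ?_⟩
    by_cases hfree : (forcedEdges a \ (a ∪ p.2)).Nonempty
    · left
      have hg : sE (a, p.2) ∈ forcedEdges a \ (a ∪ p.2) := greedy_mem (p := (a, p.2)) hfree
      rw [Finset.mem_sdiff, Finset.mem_union, not_or] at hg
      rw [Finset.insert_inter_of_mem hg.1, Finset.card_insert_of_notMem
        (fun h => hg.2.2 (Finset.mem_inter.1 h).1)]
      omega
    · rw [Finset.not_nonempty_iff_eq_empty, Finset.sdiff_eq_empty_iff_subset] at hfree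
      have hle := Finset.card_le_card (Finset.inter_subset_inter
        (Finset.subset_insert (sE (a, p.2)) p.2) (subset_refl (forcedEdges a)))
      have hcov : forcedEdges a ⊆ a ∪ insert (sE (a, p.2)) p.2 :=
        hfree.trans (Finset.union_subset_union_right (Finset.subset_insert _ _))
      rcases Nat.lt_or_ge t
        ((insert (sE (a, p.2)) p.2 ∩ forcedEdges a).card + m') with hlt | hge
      · exact Or.inl hlt
      · exact Or.inr ⟨by omega, hcov⟩

theorem enforcerWinsBy_of_lt {t : ℕ} (ht : 2 * t ≤ n.choose 2) (h : n ^ 2 + 4 * n + 4 < 8 * t) :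
    EnforcerWinsBy n (NC2 n) t := by
  refine ⟨fun p => greedy (forcedEdges p.1) p, fun p => greedy_legal _ p, fun sA hA =>
    ⟨_, ?_, subset_rfl⟩⟩
  have hE : Legal n fun p => greedy (forcedEdges p.1) p := fun p => greedy_legal _ p
  rw [NC2, Set.mem_ofPred_eq, colorable_iff]
  rintro ⟨c, hc⟩
  obtain ⟨h₁, -, h₃⟩ := play_card hA hE t ht
  obtain ⟨m, hm, hx⟩ := play_forced_greedy hA t ht
  set p := play n sA (fun p => greedy (forcedEdges p.1) p) t
  have hpos : 1 ≤ (properColorings p.1).card :=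
    Finset.card_pos.2 ⟨c, by simpa [properColorings] using hc⟩
  have hmn : m ≤ n := (Nat.pow_le_pow_iff_right (a := 2) (by norm_num)).1
    ((Nat.le_mul_of_pos_right _ hpos).trans hm)
  have hsub : p.1 ∪ (p.2 ∩ forcedEdges p.1) ⊆ bichromatic c :=
    Finset.union_subset hc (Finset.inter_subset_right.trans (forcedEdges_subset hc))
  have hcard := Finset.card_le_card hsub
  rw [Finset.card_union_of_disjoint (h₃.mono_right Finset.inter_subset_left), h₁] at hcard
  have := four_mul_card_bichromatic_le c
  omega

end Enforcer

section Avoider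

variable {n : ℕ}

theorem card_edgesAt (v : Fin n) : n ≤ (edgesAt v).card + 1 := by
  have h : (Finset.univ.erase v).image (fun x => s(v, x)) ⊆
      (edgesAt v).map ⟨Subtype.val, Subtype.val_injective⟩ := by
    intro e he
    obtain ⟨x, hx, rfl⟩ := Finset.mem_image.1 he
    have hvx : ¬ (s(v, x)).IsDiag := fun h => (Finset.ne_of_mem_erase hx) (by simpa using h.symm)
    exact Finset.mem_map.2 ⟨⟨s(v, x), hvx⟩, by simp [edgesAt], rfl⟩
  have := Finset.card_le_card h
  rw [Finset.card_map, Finset.card_image_of_injective _ (fun x y => Sym2.congr_right.1),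
    Finset.card_erase_of_mem (Finset.mem_univ _), Finset.card_univ, Fintype.card_fin] at this
  omega

theorem sdiff_union_nonempty {Q a b : Finset (Edge n)}
    (h : a.card + (b ∩ Q).card < Q.card) : (Q \ (a ∪ b)).Nonempty := by
  rw [Finset.nonempty_iff_ne_empty, Ne, Finset.sdiff_eq_empty_iff_subset]
  intro hs
  have hQ : Q ⊆ a ∪ (b ∩ Q) := fun e he => by
    have := hs he
    simp only [Finset.mem_union, Finset.mem_inter] at this ⊢
    tauto
  have := (Finset.card_le_card hQ).trans (Finset.card_union_le _ _)
  omega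

theorem exists_separating_card_eq {S T : Finset (Fin n)} (hST : Disjoint S T)
    (hS : S.card ≤ n / 2) (hT : T.card ≤ n - n / 2) :
    ∃ A : Finset (Fin n), S ⊆ A ∧ Disjoint A T ∧ A.card = n / 2 := by
  obtain ⟨A, hSA, hAT, hA⟩ := Finset.exists_subsuperset_card_eq
    (Finset.subset_compl_iff_disjoint_right.2 hST) hS
    (by rw [Finset.card_compl, Fintype.card_fin]; omega)
  exact ⟨A, hSA, Finset.subset_compl_iff_disjoint_right.1 hAT, hA⟩

theorem sq_le_four_mul_card_bichromatic {A : Finset (Fin n)} (hA : A.card = n / 2) :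
    n ^ 2 ≤ 4 * (bichromatic fun x => decide (x ∈ A)).card + 1 := by
  rw [card_bichromatic, hA]
  rcases n.even_or_odd' with ⟨m, rfl | rfl⟩
  · rw [show 2 * m / 2 = m by omega, show 2 * m - m = m by omega]
    linarith
  · rw [show (2 * m + 1) / 2 = m by omega, show 2 * m + 1 - m = m + 1 by omega]
    linarith

/-- A star with `k` edges and a disjoint set of `k` edges admit a balanced bipartition
for which all edges of the star and at most half of the other edges are bichromatic. -/
theorem exists_balanced_coloring (v : Fin n) {k : ℕ} (hk : 6 * k + 2 ≤ n)
    {a b : Finset (Edge n)} (ha : a ⊆ edgesAt v) (hak : a.card = k) (hbk : b.card = k)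
    (hab : Disjoint a b) :
    ∃ c : Fin n → Bool, n ^ 2 ≤ 4 * (bichromatic c).card + 1 ∧ a ⊆ bichromatic c ∧
      2 * (b ∩ bichromatic c).card ≤ k := by
  set L : Finset (Fin n) := Finset.univ.filter fun x => ∃ e ∈ a, e.1 = s(v, x) with hL
  set U : Finset (Fin n) := b.biUnion (fun e => e.1.toFinset) \ insert v L with hU
  have hvL : v ∉ L := by
    simp only [hL, Finset.mem_filter, not_and, not_exists]
    rintro - e - he
    exact e.2 (by simp [he])
  have hLcard : L.card ≤ k := by
    rw [← Finset.card_image_of_injective L (f := fun x => s(v, x)) fun x y => Sym2.congr_right.1,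
      ← hak, ← Finset.card_map ⟨Subtype.val, Subtype.val_injective⟩]
    refine Finset.card_le_card (Finset.image_subset_iff.2 fun x hx => ?_)
    obtain ⟨e, he, hex⟩ := (Finset.mem_filter.1 hx).2
    exact Finset.mem_map.2 ⟨e, he, hex⟩
  have hUcard : U.card ≤ 2 * k := by
    refine (Finset.card_le_card Finset.sdiff_subset).trans ?_
    rw [← hbk, mul_comm]
    refine Finset.card_biUnion_le_card_mul _ _ _ fun e _ => ?_
    rw [Sym2.card_toFinset_of_not_isDiag _ e.2]
  have hsep : ∀ A : Finset (Fin n), v ∈ A → Disjoint A L →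
      a ⊆ bichromatic fun x => decide (x ∈ A) := by
    rintro A hvA hAL ⟨e, he⟩ hea
    obtain ⟨x, rfl⟩ := Sym2.mem_iff_exists.1 (Finset.mem_filter.1 (ha hea)).2
    have hxL : x ∈ L := Finset.mem_filter.2 ⟨Finset.mem_univ _, _, hea, rfl⟩
    simp [mem_bichromatic, hvA, Finset.disjoint_right.1 hAL hxL]
  obtain ⟨A, hA, hAL, hAcard⟩ := exists_separating_card_eq (n := n) (S := insert v U) (T := L)
    (by
      refine Finset.disjoint_insert_left.2 ⟨hvL, ?_⟩
      exact Finset.sdiff_disjoint.mono_right (Finset.subset_insert _ _))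
    (by have := Finset.card_insert_le v U; omega) (by omega)
  obtain ⟨B, hB, hBL, hBcard⟩ := exists_separating_card_eq (n := n) (S := {v}) (T := L ∪ U)
    (by
      rw [Finset.disjoint_singleton_left, Finset.mem_union]
      simp [hvL, hU])
    (by rw [Finset.card_singleton]; omega)
    (by have := Finset.card_union_le L U; omega)
  rw [Finset.disjoint_union_right] at hBL
  rw [Finset.singleton_subset_iff] at hB
  rw [Finset.insert_subset_iff] at hA
  have hdisj : Disjoint (b ∩ bichromatic fun x => decide (x ∈ A))
      (b ∩ bichromatic fun x => decide (x ∈ B)) := by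
    rw [Finset.disjoint_left]
    rintro ⟨e, he⟩ h₁ h₂
    rw [Finset.mem_inter] at h₁ h₂
    have htri : ∀ x ∈ e, x = v ∨ x ∈ L ∨ x ∈ U := by
      intro x hx
      by_cases hxv : x ∈ insert v L
      · rw [Finset.mem_insert] at hxv
        tauto
      · exact Or.inr (Or.inr (Finset.mem_sdiff.2
          ⟨Finset.mem_biUnion.2 ⟨_, h₁.1, Sym2.mem_toFinset.2 hx⟩, hxv⟩))
    have hvx : ∀ x ∈ L, e ≠ s(v, x) := by
      rintro x hx rfl
      obtain ⟨f, hf, hfx⟩ := (Finset.mem_filter.1 hx).2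
      exact Finset.disjoint_left.1 hab hf (by convert h₁.1)
    induction e with
    | _ x y =>
      simp only [mem_bichromatic, ne_eq, decide_eq_decide] at h₁ h₂
      have hx := htri x (Sym2.mem_mk_left x y)
      have hy := htri y (Sym2.mem_mk_right x y)
      have hL₁ : ∀ z ∈ L, z ∉ A := fun z hz => Finset.disjoint_right.1 hAL hz
      have hL₂ : ∀ z ∈ L, z ∉ B := fun z hz => Finset.disjoint_right.1 hBL.1 hz
      have hU₁ : ∀ z ∈ U, z ∈ A := fun z hz => hA.2 hz
      have hU₂ : ∀ z ∈ U, z ∉ B := fun z hz => Finset.disjoint_right.1 hBL.2 hz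
      have hvy : x = v → y ∉ L := fun h hy => hvx y hy (by rw [h])
      have hvx' : y = v → x ∉ L := fun h hx => hvx x hx (by rw [h, Sym2.eq_swap])
      grind
  have hsum : (b ∩ bichromatic fun x => decide (x ∈ A)).card +
      (b ∩ bichromatic fun x => decide (x ∈ B)).card ≤ k := by
    rw [← Finset.card_union_of_disjoint hdisj, ← hbk]
    exact Finset.card_le_card (Finset.union_subset Finset.inter_subset_left
      Finset.inter_subset_left)
  rcases Nat.le_total (b ∩ bichromatic fun x => decide (x ∈ A)).card
    (b ∩ bichromatic fun x => decide (x ∈ B)).card with h | h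
  · exact ⟨_, sq_le_four_mul_card_bichromatic hAcard, hsep A hA.1 hAL, by omega⟩
  · exact ⟨_, sq_le_four_mul_card_bichromatic hBcard, hsep B hB hBL.1, by omega⟩

theorem play_congr {sA sA' sE : Strategy n} {k : ℕ}
    (h : ∀ t < k, sA (play n sA' sE t) = sA' (play n sA' sE t)) {t : ℕ} (ht : t ≤ k) :
    play n sA sE t = play n sA' sE t := by
  induction t with
  | zero => rfl
  | succ t ih => simp only [play, ih (by omega), h t (by omega)]

variable [Inhabited (Edge n)]

theorem play_greedy_subset_edgesAt (v : Fin n) {sE : Strategy n} (hE : Legal n sE) (t : ℕ)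
    (ht : 2 * t ≤ n) (ht' : 2 * t ≤ n.choose 2) :
    (play n (greedy (edgesAt v)) sE t).1 ⊆ edgesAt v := by
  induction t with
  | zero => simp [play]
  | succ t ih =>
    obtain ⟨h₁, h₂, -⟩ := play_card (greedy_legal (edgesAt v)) hE t (by omega)
    refine Finset.insert_subset (Finset.mem_sdiff.1 (greedy_mem (sdiff_union_nonempty ?_))).1
      (ih (by omega) (by omega))
    have := card_edgesAt v
    have := Finset.card_le_card (Finset.inter_subset_left
      (s₁ := (play n (greedy (edgesAt v)) sE t).2) (s₂ := edgesAt v))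
    omega

/-- Avoider first builds a star with `k` edges, then fixes a balanced bipartition wasting at least
`k / 2` of Enforcer's edges and sticks to it. -/
theorem le_of_enforcerWinsBy {k t : ℕ} (hk : 6 * k + 6 ≤ n) (h : EnforcerWinsBy n (NC2 n) t) :
    n ^ 2 + 2 * k ≤ 8 * t := by
  obtain ⟨sE, hE, h⟩ := h
  have v : Fin n := ⟨0, by omega⟩
  have hchoose := sq_eq_two_mul_choose_two_add n
  have hsq : 6 * n ≤ n ^ 2 := by nlinarith
  have hkc : 2 * k ≤ n.choose 2 := by omega
  obtain ⟨hk₁, hk₂, hk₃⟩ := play_card (greedy_legal (edgesAt v)) hE k hkc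
  obtain ⟨c, hc, hac, hbc⟩ := exists_balanced_coloring v (by omega)
    (play_greedy_subset_edgesAt v hE k (by omega) hkc) hk₁ hk₂ hk₃
  set sA : Strategy n := fun p =>
    if p.1.card < k then greedy (edgesAt v) p else greedy (bichromatic c) p with hsA
  have hA : Legal n sA := by
    intro p hp
    simp only [hsA]
    split_ifs
    · exact greedy_legal _ p hp
    · exact greedy_legal _ p hp
  have hplay : play n sA sE k = play n (greedy (edgesAt v)) sE k := by
    refine play_congr (fun t ht => ?_) le_rfl
    have := (play_card (greedy_legal (edgesAt v)) hE t (by omega)).1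
    simp only [hsA, if_pos (this.trans_lt ht)]
  have hinv : ∀ t, k ≤ t → 8 * t < n ^ 2 + 2 * k →
      (play n sA sE t).1 ⊆ bichromatic c ∧
        2 * ((play n sA sE t).2 ∩ bichromatic c).card + k ≤ 2 * t := by
    intro t hkt
    induction t, hkt using Nat.le_induction with
    | base =>
      intro _
      rw [hplay]
      exact ⟨hac, by omega⟩
    | succ t hkt ih =>
      intro ht
      obtain ⟨hi₁, hi₂⟩ := ih (by omega)
      have hcard := (play_card hA hE t (by omega)).1
      simp only [play]
      set p := play n sA sE t
      have hs : sA p = greedy (bichromatic c) p := by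
        simp only [hsA, if_neg (show ¬ p.1.card < k by omega)]
      refine ⟨Finset.insert_subset ?_ hi₁, ?_⟩
      · rw [hs]
        exact (Finset.mem_sdiff.1 (greedy_mem (sdiff_union_nonempty (by omega)))).1
      · have hins := Finset.card_le_card (Finset.inter_subset_inter
          (subset_refl (insert (sE (insert (sA p) p.1, p.2)) p.2))
          (Finset.subset_insert (sE (insert (sA p) p.1, p.2)) (bichromatic c)))
        rw [← Finset.insert_inter_distrib] at hins
        have := Finset.card_insert_le (sE (insert (sA p) p.1, p.2)) (p.2 ∩ bichromatic c)
        omega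
  by_contra! hlt
  obtain ⟨M, hM, hsub⟩ := h sA hA
  refine hM ((colorable_iff M).2 ⟨c, hsub.trans ?_⟩)
  refine (play_fst_mono sA sE (le_max_left t k)).trans (hinv _ (le_max_right t k) ?_).1
  rcases max_choice t k with h' | h' <;> rw [h'] <;> omega

end Avoider

/-- Theorem 2: `τ_E(NC²_n) = n²/8 + Θ(n)`. -/
theorem tauE_nonbipartite_asymptotics :
    ∃ c₁ c₂ : ℝ, 0 < c₁ ∧ 0 < c₂ ∧ ∃ n₀ : ℕ, ∀ n : ℕ, n₀ ≤ n →
      ∃ t : ℕ, tauE n (NC2 n) = (t : ℕ∞) ∧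
        c₁ * n ≤ (t : ℝ) - (n : ℝ) ^ 2 / 8 ∧
        (t : ℝ) - (n : ℝ) ^ 2 / 8 ≤ c₂ * n := by
  refine ⟨1 / 64, 1, by norm_num, by norm_num, 64, fun n hn => ?_⟩
  have : Inhabited (Edge n) := ⟨⟨s(⟨0, by omega⟩, ⟨1, by omega⟩), by simp⟩⟩
  have hchoose := sq_eq_two_mul_choose_two_add n
  have hsq : 24 * n ≤ n ^ 2 := by nlinarith
  have hwin : EnforcerWinsBy n (NC2 n) ((n ^ 2 + 4 * n + 4) / 8 + 1) :=
    enforcerWinsBy_of_lt (by omega) (by omega)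
  have hex : ∃ t, EnforcerWinsBy n (NC2 n) t := ⟨_, hwin⟩
  classical
  refine ⟨Nat.find hex, ?_, ?_, ?_⟩
  · refine IsLeast.csInf_eq ⟨⟨_, Nat.find_spec hex, rfl⟩, ?_⟩
    rintro _ ⟨t, ht, rfl⟩
    exact Nat.cast_le.2 (Nat.find_min' hex ht)
  · have h₁ := le_of_enforcerWinsBy (k := n / 12) (by omega) (Nat.find_spec hex)
    have h₂ : 8 * n ^ 2 + n ≤ 64 * Nat.find hex := by omega
    have h₃ : 8 * (n : ℝ) ^ 2 + n ≤ 64 * Nat.find hex := by exact_mod_cast h₂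
    linarith
  · have h₁ := Nat.find_min' hex hwin
    have h₂ : 8 * Nat.find hex ≤ n ^ 2 + 8 * n := by omega
    have h₃ : 8 * (Nat.find hex : ℝ) ≤ (n : ℝ) ^ 2 + 8 * n := by exact_mod_cast h₂
    linarith
end

section
/- τ_E(D_n) = (1/2)·C(n−1,2) + Θ(log n) and τ_E(T_n) = (1/2)·C(n−1,2) + Θ(log n); that is, there exist constants c₁ > 0, c₂ > 0 and n₀ such that for all n ≥ n₀, c₁·log n ≤ τ_E(D_n) − (1/2)·C(n−1,2) ≤ c₂·log n and c₁·log n ≤ τ_E(T_n) − (1/2)·C(n−1,2) ≤ c₂·log n, where C(n−1,2) = (n−1)(n−2)/2. -/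
/-- `D_n`: the family of edge sets of graphs on `Fin n` with minimum degree at least 1,
i.e. every vertex is incident with some claimed edge. -/
def Dfam (n : ℕ) : Set (Finset (Edge n)) :=
  {E | ∀ v : Fin n, ∃ e ∈ E, v ∈ e.val}

/-- `T_n`: the family of edge sets of connected spanning graphs on `Fin n`. -/
def Tfam (n : ℕ) : Set (Finset (Edge n)) :=
  {E | (toGraph n E).Connected}

namespace AvoiderEnforcer

open Finset

variable {n : ℕ}

/-- The number of edges of `E` at the vertex `v`. -/
def deg (E : Finset (Edge n)) (v : Fin n) : ℕ := #{e ∈ E | v ∈ e.1}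

lemma Edge.exists_eq (e : Edge n) : ∃ a b : Fin n, a ≠ b ∧ e.1 = s(a, b) := by
  obtain ⟨e, he⟩ := e
  induction e using Sym2.ind with
  | _ a b => exact ⟨a, b, by simpa using he, rfl⟩

lemma card_edge (n : ℕ) : Fintype.card (Edge n) = n.choose 2 := by
  have := Sym2.card_subtype_not_diag (α := Fin n)
  simpa using this

lemma deg_mono {E E' : Finset (Edge n)} (h : E ⊆ E') (v : Fin n) : deg E v ≤ deg E' v :=
  card_le_card (filter_subset_filter _ h)

lemma deg_insert_of_mem {E : Finset (Edge n)} {e : Edge n} (he : e ∉ E) {v : Fin n}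
    (hv : v ∈ e.1) : deg (insert e E) v = deg E v + 1 := by
  simp [deg, filter_insert, hv, he]

lemma deg_insert_of_notMem {E : Finset (Edge n)} {e : Edge n} {v : Fin n}
    (hv : v ∉ e.1) : deg (insert e E) v = deg E v := by
  simp [deg, filter_insert, hv]

lemma card_star (u : Fin n) {W : Finset (Fin n)} (hu : u ∉ W) :
    #{e : Edge n | u ∈ e.1 ∧ ∀ x ∈ e.1, x ≠ u → x ∈ W} = #W := by
  symm
  refine card_bij (fun w hw => ⟨s(u, w), by rw [Sym2.mk_isDiag_iff]; rintro rfl; exact hu hw⟩)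
    ?_ ?_ ?_
  · intro w hw
    simp only [mem_filter, mem_univ, true_and, Sym2.mem_iff]
    grind
  · intro a ha b hb h
    simp only [Subtype.mk.injEq, Sym2.eq_iff] at h
    grind
  · intro e he
    simp only [mem_filter, mem_univ, true_and] at he
    obtain ⟨a, b, hab, heq⟩ := Edge.exists_eq e
    rw [heq] at he
    simp only [Sym2.mem_iff] at he
    obtain ⟨rfl | rfl, h⟩ := he
    · exact ⟨b, h b (by simp) hab.symm, Subtype.ext heq.symm⟩
    · exact ⟨a, h a (by simp) hab, Subtype.ext (Sym2.eq_swap.trans heq.symm)⟩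

/-- The unclaimed edges that avoid `U`. -/
def freeOff (U : Finset (Fin n)) (A E : Finset (Edge n)) : Finset (Edge n) :=
  {e | e ∉ A ∪ E ∧ ∀ x ∈ e.1, x ∉ U}

lemma mem_freeOff {U : Finset (Fin n)} {A E : Finset (Edge n)} {e : Edge n} :
    e ∈ freeOff U A E ↔ e ∉ A ∪ E ∧ ∀ x ∈ e.1, x ∉ U := by
  simp [freeOff]

lemma card_freeOff_erase {U : Finset (Fin n)} {A E : Finset (Edge n)}
    (hA : ∀ e ∈ A, ∀ x ∈ e.1, x ∉ U) (hE : ∀ e ∈ E, ∃ x ∈ e.1, x ∉ U) {u : Fin n} (hu : u ∈ U) :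
    #(freeOff (U.erase u) A E) + deg E u = #(freeOff U A E) + #Uᶜ := by
  have h1 : freeOff (U.erase u) A E ∪ {e ∈ E | u ∈ e.1} =
      freeOff U A E ∪ ({e : Edge n | u ∈ e.1 ∧ ∀ x ∈ e.1, x ≠ u → x ∈ Uᶜ} : Finset (Edge n)) := by
    ext e
    have hA' := hA e
    have hE' := hE e
    obtain ⟨a, b, hab, heq⟩ := Edge.exists_eq e
    simp only [mem_union, mem_freeOff, mem_filter, mem_univ, true_and, mem_erase, mem_compl,
      heq, Sym2.mem_iff] at hA' hE' ⊢
    grind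
  have h2 : Disjoint (freeOff (U.erase u) A E) {e ∈ E | u ∈ e.1} := by
    rw [disjoint_left]
    intro e he he'
    simp only [mem_freeOff, mem_filter, mem_union] at he he'
    tauto
  have h3 : Disjoint (freeOff U A E)
      ({e : Edge n | u ∈ e.1 ∧ ∀ x ∈ e.1, x ≠ u → x ∈ Uᶜ} : Finset (Edge n)) := by
    rw [disjoint_left]
    intro e he he'
    simp only [mem_freeOff, mem_filter, mem_univ, true_and] at he he'
    exact he.2 u he'.1 hu
  have := congrArg card h1
  rwa [card_union_of_disjoint h2, card_union_of_disjoint h3, card_star u (by simpa using hu)] at this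

/-- The invariant, before each of his moves, of Avoider's strategy of never touching `U`.
The potential `∑ u ∈ U, 5 ^ deg E u` is at least `n` up to a small deficit; in each deficit case,
the parity of the number of unclaimed edges off `U` (and of a degree bound `m`) ensures
that it will be made up for. -/
def AvoiderInv (U : Finset (Fin n)) (A E : Finset (Edge n)) : Prop :=
  U.Nonempty ∧ (∀ e ∈ A, ∀ x ∈ e.1, x ∉ U) ∧ (∀ e ∈ E, ∃ x ∈ e.1, x ∉ U) ∧
    ∃ m, (∀ u ∈ U, m ≤ deg E u) ∧
      (n ≤ ∑ u ∈ U, 5 ^ deg E u ∨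
        (Odd #(freeOff U A E) ∧ n ≤ ∑ u ∈ U, 5 ^ deg E u + 3 * 5 ^ m) ∨
        (Even #(freeOff U A E) ∧ Odd (m + #Uᶜ) ∧ n ≤ ∑ u ∈ U, 5 ^ deg E u + 2 * 5 ^ m))

lemma AvoiderInv.start (hn : 0 < n) : AvoiderInv (univ : Finset (Fin n)) ∅ ∅ := by
  have : Nonempty (Fin n) := ⟨⟨0, hn⟩⟩
  exact ⟨univ_nonempty, by simp, by simp, 0, by simp, .inl (by simp [deg])⟩

lemma AvoiderInv.shrink {U : Finset (Fin n)} {A E : Finset (Edge n)} (h : AvoiderInv U A E)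
    (hf : freeOff U A E = ∅) (hU : 1 < #U) : ∃ U', AvoiderInv U' A E ∧ #U' < #U := by
  obtain ⟨hne, hA, hE, m, hm, hΦ⟩ := h
  obtain ⟨u, hu, hmin⟩ := exists_min_image U (deg E) hne
  have hcard := card_freeOff_erase hA hE hu
  rw [hf, card_empty, zero_add] at hcard
  have hsum := sum_erase_add U (fun u => 5 ^ deg E u) hu
  have hco : #(U.erase u)ᶜ = #Uᶜ + 1 := by
    have := card_erase_of_mem hu
    have := card_le_univ U
    rw [card_compl, card_compl]
    omega
  refine ⟨U.erase u, ⟨?_, ?_, ?_, deg E u, ?_, ?_⟩, by rw [card_erase_of_mem hu]; omega⟩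
  · rw [← card_pos, card_erase_of_mem hu]; omega
  · exact fun e he x hx hxU => hA e he x hx (mem_of_mem_erase hxU)
  · exact fun e he => (hE e he).imp fun x hx => ⟨hx.1, fun hxU => hx.2 (mem_of_mem_erase hxU)⟩
  · exact fun v hv => hmin v (mem_of_mem_erase hv)
  · have hle : 5 ^ m ≤ 5 ^ deg E u := Nat.pow_le_pow_right (by norm_num) (hm u hu)
    right
    simp only [hf, card_empty, Nat.not_odd_zero, false_and, false_or] at hΦ
    rcases Nat.even_or_odd #(freeOff (U.erase u) A E) with hpar | hpar
    · right
      refine ⟨hpar, by rw [hco]; grind, ?_⟩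
      rcases hΦ with h | ⟨-, h, h'⟩
      · omega
      · have : m + 1 ≤ deg E u := by
          refine lt_of_le_of_ne (hm u hu) ?_
          rintro rfl
          grind
        have := Nat.pow_le_pow_right (n := 5) (by norm_num) this
        rw [pow_succ] at this
        omega
    · exact .inl ⟨hpar, by omega⟩

lemma AvoiderInv.exists_freeOff_nonempty {U : Finset (Fin n)} {A E : Finset (Edge n)}
    (h : AvoiderInv U A E) :
    ∃ U', AvoiderInv U' A E ∧ ((freeOff U' A E).Nonempty ∨ #U' = 1 ∧ freeOff U' A E = ∅) := by
  induction hk : #U using Nat.strong_induction_on generalizing U with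
  | _ k ih =>
    rcases (freeOff U A E).eq_empty_or_nonempty with hf | hf
    · have := h.1.card_pos
      by_cases h1 : #U = 1
      · exact ⟨U, h, .inr ⟨h1, hf⟩⟩
      · obtain ⟨U', hU', hlt⟩ := h.shrink hf (by omega)
        exact ih _ (hk ▸ hlt) hU' rfl
    · exact ⟨U, h, .inl hf⟩

lemma AvoiderInv.card_le {U : Finset (Fin n)} {A E : Finset (Edge n)}
    (h : AvoiderInv U A E) (hU : #U = 1) (hf : freeOff U A E = ∅) :
    Fintype.card (Edge n) + Nat.log 5 n ≤ #(A ∪ E) + (n - 1) := by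
  obtain ⟨hne, hA, hE, m, hm, hΦ⟩ := h
  obtain ⟨v, rfl⟩ := card_eq_one.1 hU
  have hcard := card_freeOff_erase hA hE (mem_singleton_self v)
  have hfree : freeOff (({v} : Finset (Fin n)).erase v) A E = (A ∪ E)ᶜ := by
    ext e; simp [mem_freeOff]
  rw [hf, hfree, card_compl, card_compl, card_singleton, Fintype.card_fin, card_empty] at hcard
  have hle : 5 ^ m ≤ 5 ^ deg E v := Nat.pow_le_pow_right (by norm_num) (hm v (by simp))
  have hn : n < 5 ^ (deg E v + 1) := by
    have : 0 < 5 ^ deg E v := by positivity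
    simp only [hf, card_empty, Nat.not_odd_zero, false_and, false_or, sum_singleton] at hΦ
    rw [pow_succ]
    omega
  have := Nat.log_lt_of_lt_pow' (b := 5) (by omega) hn
  have := card_le_univ (A ∪ E)
  omega

lemma sum_pow_deg_insert {U : Finset (Fin n)} {E : Finset (Edge n)} {e : Edge n} (he : e ∉ E)
    {u : Fin n} (hu : u ∈ U) (hue : u ∈ e.1) (b : ℕ) :
    ∑ v ∈ U, (b + 1) ^ deg E v + b * (b + 1) ^ deg E u ≤
      ∑ v ∈ U, (b + 1) ^ deg (insert e E) v := by
  rw [← sum_erase_add U _ hu, ← sum_erase_add U (fun v => (b + 1) ^ deg (insert e E) v) hu,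
    deg_insert_of_mem he hue, add_assoc]
  refine add_le_add (sum_le_sum fun v _ => ?_) (by rw [pow_succ]; exact le_of_eq (by ring))
  exact Nat.pow_le_pow_right (by omega) (deg_mono (subset_insert _ _) v)

lemma AvoiderInv.step {U : Finset (Fin n)} {A E : Finset (Edge n)} (h : AvoiderInv U A E)
    {a e : Edge n} (ha : a ∈ freeOff U A E) (he : e ∉ insert a A ∪ E) :
    ∃ U', AvoiderInv U' (insert a A) (insert e E) := by
  obtain ⟨hne, hA, hE, m, hm, hΦ⟩ := h
  have haU := (mem_freeOff.1 ha).2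
  have hA' : ∀ e ∈ insert a A, ∀ x ∈ e.1, x ∉ U := by
    intro f hf
    rcases mem_insert.1 hf with rfl | hf
    · exact haU
    · exact hA f hf
  simp only [mem_union, mem_insert, not_or] at he
  obtain ⟨⟨hea, heA⟩, heE⟩ := he
  have hm' : ∀ u ∈ U, m ≤ deg (insert e E) u :=
    fun u hu => (hm u hu).trans (deg_mono (subset_insert _ _) u)
  have hpow : ∀ u ∈ U, 5 ^ m ≤ 5 ^ deg E u :=
    fun u hu => Nat.pow_le_pow_right (by norm_num) (hm u hu)
  by_cases hoff : ∀ x ∈ e.1, x ∉ U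
  · have hdeg : ∀ u ∈ U, deg (insert e E) u = deg E u :=
      fun u hu => deg_insert_of_notMem fun hue => hoff u hue hu
    have hfree : #(freeOff U (insert a A) (insert e E)) + 2 = #(freeOff U A E) := by
      have heq : freeOff U (insert a A) (insert e E) = ((freeOff U A E).erase a).erase e := by
        ext f
        simp only [mem_freeOff, mem_erase, mem_union, mem_insert]
        tauto
      have h1 := card_erase_add_one ha
      have h2 := card_erase_add_one (s := (freeOff U A E).erase a) (a := e)
        (mem_erase.2 ⟨hea, mem_freeOff.2 ⟨by simp [heA, heE], hoff⟩⟩)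
      rw [heq]; omega
    refine ⟨U, hne, hA', ?_, m, hm', ?_⟩
    · intro f hf
      rcases mem_insert.1 hf with rfl | hf
      · obtain ⟨x, y, -, hxy⟩ := Edge.exists_eq f
        have hx : x ∈ f.1 := by simp [hxy]
        exact ⟨x, hx, hoff x hx⟩
      · exact hE f hf
    · rw [sum_congr rfl fun u hu => by rw [hdeg u hu]]
      rw [← hfree] at hΦ
      rcases hΦ with h | ⟨h1, h⟩ | ⟨h1, h⟩
      · exact .inl h
      · exact .inr (.inl ⟨by grind, h⟩)
      · exact .inr (.inr ⟨by grind, h⟩)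
  · by_cases hin : ∃ x ∈ e.1, x ∉ U
    · push Not at hoff
      obtain ⟨u, hue, hu⟩ := hoff
      refine ⟨U, hne, hA', ?_, m, hm', .inl ?_⟩
      · intro f hf
        rcases mem_insert.1 hf with rfl | hf
        · exact hin
        · exact hE f hf
      · have := sum_pow_deg_insert heE hu hue 4
        have := hpow u hu
        norm_num at *
        omega
    · push Not at hin
      obtain ⟨u, v, huv, hue, hve, hle⟩ : ∃ u v : Fin n, u ≠ v ∧ u ∈ e.1 ∧ v ∈ e.1 ∧
          deg E v ≤ deg E u := by
        obtain ⟨x, y, hxy, heq⟩ := Edge.exists_eq e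
        rcases le_total (deg E x) (deg E y) with h | h
        · exact ⟨y, x, hxy.symm, by simp [heq], by simp [heq], h⟩
        · exact ⟨x, y, hxy, by simp [heq], by simp [heq], h⟩
      have hu := hin u hue
      have hv := hin v hve
      have huU : u ∈ U.erase v := mem_erase.2 ⟨huv, hu⟩
      refine ⟨U.erase v, ⟨u, huU⟩, fun f hf x hx hxU => hA' f hf x hx (mem_of_mem_erase hxU), ?_,
        m, fun w hw => hm' w (mem_of_mem_erase hw), .inl ?_⟩
      · intro f hf
        rcases mem_insert.1 hf with rfl | hf
        · exact ⟨v, hve, notMem_erase v U⟩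
        · exact (hE f hf).imp fun x hx => ⟨hx.1, fun hxU => hx.2 (mem_of_mem_erase hxU)⟩
      · have h1 := sum_pow_deg_insert heE huU hue 4
        have h2 := hpow u hu
        have h3 := sum_erase_add U (fun u => 5 ^ deg E u) hv
        have h4 : 5 ^ deg E v ≤ 5 ^ deg E u := Nat.pow_le_pow_right (by norm_num) hle
        norm_num at *
        omega

lemma exists_notMem_of_card_lt {s : Finset (Edge n)} (h : #s < Fintype.card (Edge n)) :
    ∃ e, e ∉ s := by
  by_contra! h'
  rw [eq_univ_of_forall h', card_univ] at h
  exact lt_irrefl _ h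

/-- A legal strategy that follows `R` whenever some unclaimed edge satisfies `R`. -/
lemma exists_legal_strategy (h : 0 < Fintype.card (Edge n)) (R : Position n → Edge n → Prop) :
    ∃ s : Strategy n, Legal n s ∧ ∀ p, (∃ e ∉ p.1 ∪ p.2, R p e) →
      s p ∉ p.1 ∪ p.2 ∧ R p (s p) := by
  have key : ∀ p : Position n, ∃ e : Edge n, (p.1 ∪ p.2 ≠ univ → e ∉ p.1 ∪ p.2) ∧
      ((∃ e ∉ p.1 ∪ p.2, R p e) → e ∉ p.1 ∪ p.2 ∧ R p e) := by
    intro p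
    by_cases h1 : ∃ e ∉ p.1 ∪ p.2, R p e
    · obtain ⟨e, he⟩ := h1
      exact ⟨e, fun _ => he.1, fun _ => he⟩
    · by_cases h2 : p.1 ∪ p.2 = univ
      · obtain ⟨e⟩ := Fintype.card_pos_iff.1 h
        exact ⟨e, fun h => absurd h2 h, fun h => absurd h h1⟩
      · obtain ⟨e, he⟩ : ∃ e, e ∉ p.1 ∪ p.2 := by
          by_contra! h'
          exact h2 (eq_univ_of_forall h')
        exact ⟨e, fun _ => he, fun h => absurd h h1⟩
  choose s hs using key
  exact ⟨s, fun p => (hs p).1, fun p => (hs p).2⟩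

lemma card_play_le (sA sE : Strategy n) (t : ℕ) :
    #((play n sA sE t).1 ∪ (play n sA sE t).2) ≤ 2 * t := by
  have h : #(play n sA sE t).1 ≤ t ∧ #(play n sA sE t).2 ≤ t := by
    induction t with
    | zero => simp [play]
    | succ t ih =>
      exact ⟨(card_insert_le _ _).trans (by omega), (card_insert_le _ _).trans (by omega)⟩
  have := card_union_le (play n sA sE t).1 (play n sA sE t).2
  omega

/-- Some vertex can be kept isolated by Avoider. -/
def AvoiderSafe (p : Position n) : Prop := ∃ U, AvoiderInv U p.1 p.2

lemma AvoiderSafe.exists_move {p : Position n} (h : AvoiderSafe p)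
    (hp : #(p.1 ∪ p.2) + (n - 1) < Fintype.card (Edge n) + Nat.log 5 n) :
    ∃ a ∉ p.1 ∪ p.2, (∃ v, ∀ e ∈ insert a p.1, v ∉ e.1) ∧
      ∀ e ∉ insert a p.1 ∪ p.2, AvoiderSafe (insert a p.1, insert e p.2) := by
  obtain ⟨U, hU⟩ := h
  obtain ⟨U, hU, ⟨a, ha⟩ | ⟨h1, hf⟩⟩ := hU.exists_freeOff_nonempty
  · refine ⟨a, (mem_freeOff.1 ha).1, ?_, fun e he => hU.step ha he⟩
    obtain ⟨⟨v, hv⟩, hA, -⟩ := hU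
    refine ⟨v, fun e he hve => ?_⟩
    rcases mem_insert.1 he with rfl | he
    · exact (mem_freeOff.1 ha).2 v hve hv
    · exact hA e he v hve hv
  · have := hU.card_le h1 hf
    omega

lemma le_of_enforcerWinsBy (hn : 2 ≤ n) {t : ℕ} (h : EnforcerWinsBy n (Dfam n) t) :
    Fintype.card (Edge n) + Nat.log 5 n + 2 ≤ 2 * t + (n - 1) := by
  by_contra! hlt
  have hpos : 0 < Fintype.card (Edge n) := by
    rw [card_edge]; exact Nat.choose_pos hn
  have hlog : Nat.log 5 n < n := Nat.log_lt_self 5 (by omega)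
  obtain ⟨sE, hE, hwin⟩ := h
  obtain ⟨sA, hA, hsA⟩ := exists_legal_strategy hpos fun p a =>
    (∃ v, ∀ e ∈ insert a p.1, v ∉ e.1) ∧
      ∀ e ∉ insert a p.1 ∪ p.2, AvoiderSafe (insert a p.1, insert e p.2)
  have hmove : ∀ s, 2 * s + (n - 1) < Fintype.card (Edge n) + Nat.log 5 n →
      AvoiderSafe (play n sA sE s) →
      (∃ v, ∀ e ∈ (play n sA sE (s + 1)).1, v ∉ e.1) ∧
      ∀ e ∉ (play n sA sE (s + 1)).1 ∪ (play n sA sE s).2,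
        AvoiderSafe ((play n sA sE (s + 1)).1, insert e (play n sA sE s).2) := by
    intro s hs hsafe
    have := card_play_le sA sE s
    exact (hsA _ (hsafe.exists_move (by omega))).2
  have hsafe : ∀ s, 2 * s + (n - 1) < Fintype.card (Edge n) + Nat.log 5 n →
      AvoiderSafe (play n sA sE s) := by
    intro s
    induction s with
    | zero => exact fun _ => ⟨univ, AvoiderInv.start (by omega)⟩
    | succ s ih =>
      intro hs
      refine (hmove s (by omega) (ih (by omega))).2 _ (hE (_, _) ?_)
      intro (hfull : insert (sA (play n sA sE s)) (play n sA sE s).1 ∪ (play n sA sE s).2 = univ)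
      have h1 := congrArg card hfull
      have h2 := card_play_le sA sE s
      have h3 := card_insert_le (sA (play n sA sE s))
        ((play n sA sE s).1 ∪ (play n sA sE s).2)
      rw [card_univ, insert_union] at h1
      omega
  obtain ⟨L, hL, hsub⟩ := hwin sA hA
  cases t with
  | zero =>
    obtain ⟨e, he, -⟩ := hL ⟨0, by omega⟩
    simpa [play] using hsub he
  | succ s =>
    obtain ⟨v, hv⟩ := (hmove s (by omega) (hsafe s (by omega))).1
    obtain ⟨e, he, hve⟩ := hL v
    exact hv e (hsub he) hve

/-- The edges inside connected components of the graph of `A`. -/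
def Internal (A : Finset (Edge n)) (e : Edge n) : Prop :=
  ∀ x ∈ e.1, ∀ y ∈ e.1, (toGraph n A).Reachable x y

/-- The vertex `v` is not isolated in the graph of `A`. -/
def Touched (A : Finset (Edge n)) (v : Fin n) : Prop := ∃ e ∈ A, v ∈ e.1

lemma toGraph_adj {A : Finset (Edge n)} {x y : Fin n} :
    (toGraph n A).Adj x y ↔ ∃ e ∈ A, e.1 = s(x, y) := by
  rw [toGraph, SimpleGraph.fromEdgeSet_adj]
  constructor
  · rintro ⟨⟨e, he, h⟩, -⟩
    exact ⟨e, he, h⟩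
  · rintro ⟨e, he, h⟩
    refine ⟨⟨e, he, h⟩, ?_⟩
    rintro rfl
    exact e.2 (h ▸ rfl)

lemma toGraph_mono {A A' : Finset (Edge n)} (h : A ⊆ A') : toGraph n A ≤ toGraph n A' := by
  intro x y hxy
  rw [toGraph_adj] at hxy ⊢
  exact hxy.imp fun e he => ⟨h he.1, he.2⟩

lemma Internal.mono {A A' : Finset (Edge n)} (h : A ⊆ A') {e : Edge n} (he : Internal A e) :
    Internal A' e :=
  fun x hx y hy => (he x hx y hy).mono (toGraph_mono h)

lemma Touched.mono {A A' : Finset (Edge n)} (h : A ⊆ A') {v : Fin n} (hv : Touched A v) :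
    Touched A' v :=
  hv.imp fun _ he => ⟨h he.1, he.2⟩

lemma Internal.touched {A : Finset (Edge n)} {e : Edge n} (he : Internal A e) :
    ∀ x ∈ e.1, Touched A x := by
  intro x hx
  obtain ⟨y, hy, hxy⟩ : ∃ y ∈ e.1, x ≠ y := by
    obtain ⟨a, b, hab, heq⟩ := Edge.exists_eq e
    rw [heq] at hx ⊢
    rcases Sym2.mem_iff.1 hx with rfl | rfl
    · exact ⟨b, by simp, hab⟩
    · exact ⟨a, by simp, hab.symm⟩
  obtain ⟨p⟩ := he x hx y hy
  cases p with
  | nil => exact absurd rfl hxy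
  | cons h _ =>
    obtain ⟨f, hf, hfeq⟩ := toGraph_adj.1 h
    exact ⟨f, hf, by simp [hfeq]⟩

/-- The number of connected components of the graph of `A`. -/
noncomputable def numComp (A : Finset (Edge n)) : ℕ :=
  Nat.card (toGraph n A).ConnectedComponent

lemma numComp_mono {A A' : Finset (Edge n)} (h : A ⊆ A') : numComp A' ≤ numComp A :=
  Nat.card_le_card_of_surjective _
    (SimpleGraph.ConnectedComponent.surjective_map_ofLE (toGraph_mono h))

lemma numComp_insert_lt {A : Finset (Edge n)} {e : Edge n} (he : ¬ Internal A e) :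
    numComp (insert e A) < numComp A := by
  have hle := toGraph_mono (subset_insert e A)
  have hsurj := SimpleGraph.ConnectedComponent.surjective_map_ofLE hle
  refine lt_of_le_of_ne (Nat.card_le_card_of_surjective _ hsurj) fun heq => he ?_
  have hinj := (hsurj.bijective_of_nat_card_le heq.ge).1
  have hint : Internal (insert e A) e := by
    intro x hx y hy
    by_cases hxy : x = y
    · rw [hxy]
    · refine SimpleGraph.Adj.reachable (toGraph_adj.2 ⟨e, mem_insert_self _ _, ?_⟩)
      exact (Sym2.mem_and_mem_iff hxy).1 ⟨hx, hy⟩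
  intro x hx y hy
  refine SimpleGraph.ConnectedComponent.exact (hinj ?_)
  exact SimpleGraph.ConnectedComponent.sound (hint x hx y hy)

open Classical in
/-- The edges of `E` that join different components of the graph of `A`. -/
noncomputable def crossing (A E : Finset (Edge n)) : Finset (Edge n) := {e ∈ E | ¬ Internal A e}

open Classical in
/-- The vertices isolated in the graph of `A`. -/
noncomputable def isolated (A : Finset (Edge n)) : Finset (Fin n) := {v | ¬ Touched A v}

open Classical in
/-- The edges of `E` at vertices isolated in the graph of `A`. -/
noncomputable def touching (A E : Finset (Edge n)) : Finset (Edge n) :=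
  {e ∈ E | ∃ x ∈ e.1, x ∈ isolated A}

lemma mem_isolated {A : Finset (Edge n)} {v : Fin n} : v ∈ isolated A ↔ ¬ Touched A v := by
  simp [isolated]

lemma isolated_anti {A A' : Finset (Edge n)} (h : A ⊆ A') : isolated A' ⊆ isolated A := by
  intro v hv
  rw [mem_isolated] at hv ⊢
  exact fun h' => hv (h'.mono h)

lemma crossing_anti {A A' : Finset (Edge n)} (h : A ⊆ A') (E : Finset (Edge n)) :
    crossing A' E ⊆ crossing A E := by
  intro e he
  simp only [crossing, mem_filter] at he ⊢
  exact ⟨he.1, fun h' => he.2 (h'.mono h)⟩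

lemma touching_anti {A A' : Finset (Edge n)} (h : A ⊆ A') (E : Finset (Edge n)) :
    touching A' E ⊆ touching A E := by
  intro e he
  simp only [touching, mem_filter] at he ⊢
  exact ⟨he.1, he.2.imp fun x hx => ⟨hx.1, isolated_anti h hx.2⟩⟩

lemma deg_le_card_touching {A E : Finset (Edge n)} {u : Fin n} (hu : u ∈ isolated A) :
    deg E u ≤ #(touching A E) := by
  refine card_le_card fun e he => ?_
  simp only [touching, mem_filter] at he ⊢
  exact ⟨he.1, u, he.2, hu⟩

/-- The invariant of Enforcer's strategy before each of his moves. -/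
def PreMove (A E : Finset (Edge n)) : Prop :=
  #(crossing A E) + numComp A + 1 ≤ n ∧ #(touching A E) + 1 ≤ #(isolated A)ᶜ ∧
    ∑ u ∈ isolated A, 2 ^ deg E u ≤ n

/-- The invariant of Enforcer's strategy after each of his moves. -/
def PostMove (A E : Finset (Edge n)) : Prop :=
  (#(crossing A E) + numComp A + 1 ≤ n ∨
    (∀ e ∉ A ∪ E, ¬ Internal A e) ∧ #(crossing A E) + numComp A ≤ n) ∧
  ((#(touching A E) + 1 ≤ #(isolated A)ᶜ ∧ ∑ u ∈ isolated A, 2 ^ deg E u ≤ n) ∨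
    (∀ e ∉ A ∪ E, ∃ x ∈ e.1, x ∈ isolated A) ∧ #(touching A E) ≤ #(isolated A)ᶜ ∧
      ∃ m, (∀ u ∈ isolated A, m ≤ deg E u) ∧ ∑ u ∈ isolated A, 2 ^ deg E u ≤ n + 2 ^ m)

/-- Enforcer prefers edges inside components of Avoider's graph, then edges between
nontrivial components, then edges at isolated vertices of the smallest degree. -/
def Preferred (p : Position n) (e : Edge n) : Prop :=
  (¬ Internal p.1 e → ∀ f ∉ p.1 ∪ p.2, ¬ Internal p.1 f) ∧
  ((∃ x ∈ e.1, x ∈ isolated p.1) → (∀ f ∉ p.1 ∪ p.2, ∃ x ∈ f.1, x ∈ isolated p.1) ∧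
    ∃ u w, e.1 = s(u, w) ∧ u ∈ isolated p.1 ∧ w ∉ isolated p.1 ∧
      ∀ v ∈ isolated p.1, deg p.2 u ≤ deg p.2 v)

lemma postMove_start (n : ℕ) : PostMove (∅ : Finset (Edge n)) ∅ := by
  have hiso : isolated (∅ : Finset (Edge n)) = univ := by
    ext; simp [mem_isolated, Touched]
  have hint : ∀ e : Edge n, ¬ Internal ∅ e := by
    intro e he
    obtain ⟨a, b, hab, heq⟩ := Edge.exists_eq e
    obtain ⟨f, hf, -⟩ := he.touched a (by simp [heq])
    simp at hf
  refine ⟨.inr ⟨fun e _ => hint e, ?_⟩, .inr ⟨fun e _ => ?_, ?_, 0, ?_, ?_⟩⟩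
  · have := Nat.card_le_card_of_surjective (toGraph n ∅).connectedComponentMk
      (fun c => c.exists_rep)
    simpa [crossing, numComp] using this
  · obtain ⟨a, b, hab, heq⟩ := Edge.exists_eq e
    exact ⟨a, by simp [heq], by simp [hiso]⟩
  · simp [touching]
  · simp
  · simp [hiso, deg]

lemma PostMove.preMove {A E : Finset (Edge n)} (h : PostMove A E) {a : Edge n}
    (ha : a ∉ A ∪ E) : PreMove (insert a A) E := by
  obtain ⟨h1, h2⟩ := h
  have hsub := subset_insert a A
  have hc := card_le_card (crossing_anti hsub E)
  have ht := card_le_card (touching_anti hsub E)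
  have hi := isolated_anti hsub
  refine ⟨?_, ?_⟩
  · rcases h1 with h1 | ⟨h1, h1'⟩
    · have := numComp_mono hsub
      omega
    · have := numComp_insert_lt (h1 a ha)
      omega
  · rcases h2 with ⟨h2, h3⟩ | ⟨h2, h3, m, hm, hΦ⟩
    · exact ⟨(by omega : _ ≤ #(isolated A)ᶜ).trans (card_le_card (compl_subset_compl.2 hi)),
        (sum_le_sum_of_subset hi).trans h3⟩
    · obtain ⟨u, hua, hu⟩ := h2 a ha
      have hi' : isolated (insert a A) ⊆ (isolated A).erase u := by
        refine subset_erase.2 ⟨hi, fun h => mem_isolated.1 h ⟨a, mem_insert_self _ _, hua⟩⟩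
      constructor
      · have h4 := card_le_card hi'
        have h5 := card_erase_add_one hu
        have h6 := card_le_univ (isolated A)
        rw [card_compl] at h3 ⊢
        omega
      · have h4 := sum_le_sum_of_subset (f := fun v => 2 ^ deg E v) hi'
        have h5 := sum_erase_add (isolated A) (fun v => 2 ^ deg E v) hu
        have h6 : 2 ^ m ≤ 2 ^ deg E u := Nat.pow_le_pow_right (by norm_num) (hm u hu)
        omega

lemma PreMove.exists_preferred {A E : Finset (Edge n)} (h : PreMove A E)
    (hfree : ∃ e, e ∉ A ∪ E) : ∃ e ∉ A ∪ E, Preferred (A, E) e := by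
  by_cases h1 : ∃ e ∉ A ∪ E, Internal A e
  · obtain ⟨e, he, hint⟩ := h1
    refine ⟨e, he, fun h => absurd hint h, ?_⟩
    rintro ⟨x, hx, hxi⟩
    exact absurd (hint.touched x hx) (mem_isolated.1 hxi)
  push Not at h1
  by_cases h2 : ∃ e ∉ A ∪ E, ∀ x ∈ e.1, x ∉ isolated A
  · obtain ⟨e, he, hoff⟩ := h2
    exact ⟨e, he, fun _ => h1, fun ⟨x, hx, hxi⟩ => absurd hxi (hoff x hx)⟩
  push Not at h2
  obtain ⟨f, hf⟩ := hfree
  obtain ⟨x, -, hx⟩ := h2 f hf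
  obtain ⟨u, hu, hmin⟩ := exists_min_image (isolated A) (deg E) ⟨x, hx⟩
  obtain ⟨e, he, hue, hew⟩ : ∃ e ∉ A ∪ E, u ∈ e.1 ∧
      ∀ x ∈ e.1, x ≠ u → x ∈ (isolated A)ᶜ := by
    by_contra! hcon
    have hstar := card_star u (W := (isolated A)ᶜ) (by simpa using hu)
    have hle : #{e : Edge n | u ∈ e.1 ∧ ∀ x ∈ e.1, x ≠ u → x ∈ (isolated A)ᶜ} ≤ deg E u := by
      refine card_le_card fun e he => ?_
      simp only [mem_filter, mem_univ, true_and] at he ⊢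
      refine ⟨?_, he.1⟩
      by_contra heE
      by_cases heA : e ∈ A
      · exact mem_isolated.1 hu ⟨e, heA, he.1⟩
      · obtain ⟨x, hx, hxu, hxW⟩ := hcon e (by simp [heA, heE]) he.1
        exact hxW (he.2 x hx hxu)
    have := deg_le_card_touching (E := E) hu
    have := h.2.1
    omega
  obtain ⟨w, hw⟩ := hue
  have hwu : w ≠ u := by
    rintro rfl
    exact e.2 (hw ▸ rfl)
  have hwi := hew w (by simp [hw]) hwu
  exact ⟨e, he, fun _ => h1, fun _ => ⟨h2, u, w, hw, hu, by simpa using hwi, hmin⟩⟩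

lemma PreMove.postMove {A E : Finset (Edge n)} (h : PreMove A E) {e : Edge n}
    (he : e ∉ A ∪ E) (hpref : Preferred (A, E) e) : PostMove A (insert e E) := by
  obtain ⟨h1, h2, h3⟩ := h
  obtain ⟨hp1, hp2⟩ := hpref
  dsimp only at hp1 hp2
  have hfree : ∀ f ∉ A ∪ insert e E, f ∉ A ∪ E := by
    intro f hf h
    exact hf (union_subset_union_right (subset_insert _ _) h)
  have heE : e ∉ E := fun h => he (mem_union_right _ h)
  constructor
  · by_cases hint : Internal A e
    · left
      rwa [crossing, filter_insert, if_neg (not_not.2 hint)]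
    · refine .inr ⟨fun f hf => hp1 hint f (hfree f hf), ?_⟩
      rw [crossing, filter_insert, if_pos hint]
      have := card_insert_le e (crossing A E)
      rw [crossing] at this h1
      omega
  · by_cases hiso : ∃ x ∈ e.1, x ∈ isolated A
    · obtain ⟨hoff, u, w, heq, hu, hw, hmin⟩ := hp2 hiso
      refine .inr ⟨fun f hf => hoff f (hfree f hf), ?_, deg E u, ?_, ?_⟩
      · rw [touching, filter_insert, if_pos hiso]
        have := card_insert_le e (touching A E)
        rw [touching] at this h2
        omega
      · exact fun v hv => (hmin v hv).trans (deg_mono (subset_insert _ _) v)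
      · have hsum : ∑ v ∈ (isolated A).erase u, 2 ^ deg (insert e E) v =
            ∑ v ∈ (isolated A).erase u, 2 ^ deg E v := by
          refine sum_congr rfl fun v hv => ?_
          rw [mem_erase] at hv
          rw [deg_insert_of_notMem]
          rw [heq, Sym2.mem_iff]
          rintro (rfl | rfl)
          · exact hv.1 rfl
          · exact hw hv.2
        rw [← sum_erase_add _ _ hu] at h3 ⊢
        rw [hsum, deg_insert_of_mem heE (by simp [heq]), pow_succ]
        omega
    · left
      rw [touching, filter_insert, if_neg hiso]
      refine ⟨h2, le_of_eq_of_le (sum_congr rfl fun v hv => ?_) h3⟩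
      rw [deg_insert_of_notMem fun hve => hiso ⟨v, hve, hv⟩]

lemma mul_le_card_cut (S : Finset (Fin n)) :
    #S * #Sᶜ ≤ #{e : Edge n | (∃ x ∈ e.1, x ∈ S) ∧ ∃ x ∈ e.1, x ∉ S} := by
  rw [← card_product]
  have hne : ∀ p ∈ S ×ˢ Sᶜ, p.1 ≠ p.2 := by
    intro p hp h
    rw [mem_product, mem_compl, h] at hp
    exact hp.2 hp.1
  rw [← card_attach]
  refine card_le_card_of_injOn
    (fun p => ⟨s(p.1.1, p.1.2), by rw [Sym2.mk_isDiag_iff]; exact hne _ p.2⟩) ?_ ?_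
  · rintro ⟨⟨x, y⟩, hp⟩ -
    rw [mem_product, mem_compl] at hp
    simp only [coe_filter, mem_univ, true_and, Set.mem_ofPred_eq]
    exact ⟨⟨x, by simp, hp.1⟩, y, by simp, hp.2⟩
  · rintro ⟨⟨x, y⟩, hp⟩ - ⟨⟨x', y'⟩, hp'⟩ - h
    simp only [Subtype.mk.injEq, Sym2.eq_iff, mem_product, mem_compl] at h hp hp' ⊢
    grind

lemma PreMove.connected (hn : 2 ≤ n) {A E : Finset (Edge n)} (h : PreMove A E)
    (hcard : Fintype.card (Edge n) + Nat.log 2 n + 2 ≤ #(A ∪ E) + n) :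
    (toGraph n A).Connected := by
  have : Nonempty (Fin n) := ⟨⟨0, by omega⟩⟩
  refine ⟨fun a b => ?_⟩
  by_contra hab
  classical
  obtain ⟨h1, h2, h3⟩ := h
  have hcomp : 2 ≤ numComp A := by
    have : Nontrivial (toGraph n A).ConnectedComponent :=
      ⟨_, _, fun h => hab (SimpleGraph.ConnectedComponent.exact h)⟩
    exact Finite.one_lt_card
  let S : Finset (Fin n) := {x | (toGraph n A).Reachable a x}
  have hS : ∀ x, x ∈ S ↔ (toGraph n A).Reachable a x := by simp [S]
  have hcut := mul_le_card_cut S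
  set C : Finset (Edge n) := {e : Edge n | (∃ x ∈ e.1, x ∈ S) ∧ ∃ x ∈ e.1, x ∉ S} with hC
  have hCint : ∀ e ∈ C, ¬ Internal A e := by
    intro e he hint
    obtain ⟨⟨x, hx, hxS⟩, y, hy, hyS⟩ := (mem_filter.1 he).2
    rw [hS] at hxS hyS
    exact hyS (hxS.trans (hint x hx y hy))
  have hCA : ∀ e ∈ C, e ∉ A := by
    intro e he heA
    refine hCint e he fun x hx y hy => ?_
    by_cases hxy : x = y
    · rw [hxy]
    · exact (toGraph_adj.2 ⟨e, heA, (Sym2.mem_and_mem_iff hxy).1 ⟨hx, hy⟩⟩).reachable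
  have hfree : #(A ∪ E)ᶜ + #(A ∪ E) = Fintype.card (Edge n) := card_compl_add_card _
  have hCE : #C ≤ #(A ∪ E)ᶜ + #{e ∈ E | e ∈ C} := by
    refine (card_le_card fun e he => ?_).trans (card_union_le _ _)
    have := hCA e he
    simp only [mem_union, mem_compl, mem_filter]
    tauto
  have hS1 : 0 < #S := card_pos.2 ⟨a, (hS a).2 (SimpleGraph.Reachable.refl a)⟩
  have hS2 : 0 < #Sᶜ := card_pos.2 ⟨b, by simpa [hS] using hab⟩
  have hSn : #S + #Sᶜ = n := by simp
  have key : ∀ v, (∀ e ∈ C, v ∈ e.1) → (∀ e ∈ A, v ∉ e.1) → n - 1 ≤ #C → False := by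
    intro v hvC hvA hle
    have hv : v ∈ isolated A := mem_isolated.2 fun ⟨e, he, hve⟩ => hvA e he hve
    have hd : #{e ∈ E | e ∈ C} ≤ deg E v :=
      card_le_card fun e he => by
        rw [mem_filter] at he ⊢
        exact ⟨he.1, hvC e he.2⟩
    have hpow : 2 ^ deg E v ≤ n :=
      (single_le_sum (f := fun u => 2 ^ deg E u) (fun _ _ => Nat.zero_le _) hv).trans h3
    have := Nat.le_log_of_pow_le (by norm_num) hpow
    omega
  have hAS : ∀ e ∈ A, ∀ x ∈ e.1, ∀ y ∈ e.1, x ∈ S → y ∈ S := by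
    intro e he x hx y hy hxS
    by_contra hyS
    exact hCA e (mem_filter.2 ⟨mem_univ _, ⟨x, hx, hxS⟩, y, hy, hyS⟩) he
  by_cases hs1 : #S = 1
  · obtain ⟨v, hv⟩ := card_eq_one.1 hs1
    refine key v (fun e he => ?_) (fun e he hve => ?_) ?_
    · obtain ⟨⟨x, hx, hxS⟩, -⟩ := (mem_filter.1 he).2
      rw [hv, mem_singleton] at hxS
      exact hxS ▸ hx
    · obtain ⟨x, y, hxy, heq⟩ := Edge.exists_eq e
      have h4 := hAS e he v hve x (by simp [heq]) (by simp [hv])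
      have h5 := hAS e he v hve y (by simp [heq]) (by simp [hv])
      rw [hv, mem_singleton] at h4 h5
      exact hxy (h4.trans h5.symm)
    · rw [hs1, one_mul] at hcut
      omega
  by_cases hs2 : #Sᶜ = 1
  · obtain ⟨v, hv⟩ := card_eq_one.1 hs2
    have hv' : ∀ x, x ∉ S ↔ x = v := fun x => by rw [← mem_compl, hv, mem_singleton]
    refine key v (fun e he => ?_) (fun e he hve => ?_) ?_
    · obtain ⟨-, x, hx, hxS⟩ := (mem_filter.1 he).2
      exact (hv' x).1 hxS ▸ hx
    · obtain ⟨x, y, hxy, heq⟩ := Edge.exists_eq e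
      have h4 := mt (hAS e he x (by simp [heq]) v hve) ((hv' v).2 rfl)
      have h5 := mt (hAS e he y (by simp [heq]) v hve) ((hv' v).2 rfl)
      rw [hv'] at h4 h5
      exact hxy (h4.trans h5.symm)
    · rw [hs2, mul_one] at hcut
      omega
  have hx : #{e ∈ E | e ∈ C} ≤ #(crossing A E) :=
    card_le_card fun e he => by
      rw [mem_filter] at he
      exact mem_filter.2 ⟨he.1, hCint e he.2⟩
  have hmul : 2 * (n - 2) ≤ #S * #Sᶜ := by
    obtain ⟨p, hp⟩ : ∃ p, #S = p + 2 := ⟨#S - 2, by omega⟩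
    obtain ⟨q, hq⟩ : ∃ q, #Sᶜ = q + 2 := ⟨#Sᶜ - 2, by omega⟩
    have : n - 2 = p + q + 2 := by omega
    rw [this, hp, hq]
    nlinarith
  omega

lemma exists_enforcerWinsBy (hn : 2 ≤ n) (hlog : Nat.log 2 n + 3 ≤ n) :
    ∃ t, EnforcerWinsBy n (Tfam n) t ∧
      2 * t + (n - 1) ≤ Fintype.card (Edge n) + Nat.log 2 n + 3 := by
  have hM := card_edge n
  have hMn : n - 1 ≤ Fintype.card (Edge n) := by
    obtain ⟨k, rfl⟩ : ∃ k, n = k + 2 := ⟨n - 2, by omega⟩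
    rw [hM, Nat.choose_succ_succ' (k + 1) 1]
    simp
  have hpos : 0 < Fintype.card (Edge n) := by omega
  generalize hMdef : Fintype.card (Edge n) = M at *
  obtain ⟨s, hs⟩ : ∃ s, s = (M - (n - 1) + Nat.log 2 n + 1) / 2 := ⟨_, rfl⟩
  refine ⟨s + 1, ?_, by omega⟩
  obtain ⟨sE, hE, hsE⟩ := exists_legal_strategy (by omega) (Preferred (n := n))
  refine ⟨sE, hE, fun sA hA => ⟨_, ?_, subset_rfl⟩⟩
  have hA' : ∀ r, #((play n sA sE r).1 ∪ (play n sA sE r).2) = 2 * r → 2 * r < M →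
      PostMove (play n sA sE r).1 (play n sA sE r).2 →
      PreMove (play n sA sE (r + 1)).1 (play n sA sE r).2 ∧
        #((play n sA sE (r + 1)).1 ∪ (play n sA sE r).2) = 2 * r + 1 := by
    intro r hr hlt hpost
    have hnew := hA (play n sA sE r) fun hfull => by
      rw [hfull, card_univ] at hr
      omega
    refine ⟨hpost.preMove hnew, ?_⟩
    change #(insert _ _ ∪ _) = _
    rw [insert_union, card_insert_of_notMem hnew, hr]
  have hinv : ∀ r, 2 * r ≤ M → PostMove (play n sA sE r).1 (play n sA sE r).2 ∧
      #((play n sA sE r).1 ∪ (play n sA sE r).2) = 2 * r := by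
    intro r
    induction r with
    | zero => exact fun _ => ⟨postMove_start n, by simp [play]⟩
    | succ r ih =>
      intro hr
      obtain ⟨hpost, hcard⟩ := ih (by omega)
      obtain ⟨hpre, hcard'⟩ := hA' r hcard (by omega) hpost
      obtain ⟨hnew, hpref⟩ := hsE ((play n sA sE (r + 1)).1, (play n sA sE r).2)
        (hpre.exists_preferred (exists_notMem_of_card_lt (by omega)))
      refine ⟨hpre.postMove hnew hpref, ?_⟩
      have := card_insert_of_notMem hnew
      rw [← union_insert, hcard'] at this
      exact this
  obtain ⟨hpost, hcard⟩ := hinv s (by omega)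
  obtain ⟨hpre, hcard'⟩ := hA' s hcard (by omega) hpost
  exact hpre.connected hn (by omega)

lemma enforcerWinsBy_dfam (hn : 2 ≤ n) {t : ℕ} (h : EnforcerWinsBy n (Tfam n) t) :
    EnforcerWinsBy n (Dfam n) t := by
  obtain ⟨sE, hE, hwin⟩ := h
  refine ⟨sE, hE, fun sA hA => ?_⟩
  obtain ⟨L, hL, hsub⟩ := hwin sA hA
  refine ⟨L, fun v => ?_, hsub⟩
  have : Nontrivial (Fin n) := Fin.nontrivial_iff_two_le.2 hn
  obtain ⟨w, hw⟩ := SimpleGraph.Preconnected.exists_adj_of_nontrivial hL.preconnected v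
  obtain ⟨e, he, heq⟩ := toGraph_adj.1 hw
  exact ⟨e, he, by simp [heq]⟩

lemma exists_tauE_eq {F : Set (Finset (Edge n))} {t : ℕ} (h : EnforcerWinsBy n F t) :
    ∃ s : ℕ, tauE n F = s ∧ EnforcerWinsBy n F s ∧ s ≤ t := by
  obtain ⟨s, hs, heq⟩ := csInf_mem
    (Set.Nonempty.image (fun t : ℕ => (t : ℕ∞)) (s := {t | EnforcerWinsBy n F t}) ⟨t, h⟩)
  refine ⟨s, heq.symm, hs, ?_⟩
  have : (s : ℕ∞) ≤ t := heq.trans_le (sInf_le ⟨t, h, rfl⟩)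
  exact_mod_cast this

lemma asymptotics_of_bounds (hn : 2 ≤ n) {t : ℕ}
    (h1 : Fintype.card (Edge n) + Nat.log 5 n + 2 ≤ 2 * t + (n - 1))
    (h2 : 2 * t + (n - 1) ≤ Fintype.card (Edge n) + Nat.log 2 n + 3) :
    1 / 8 * Real.log n ≤ (t : ℝ) - ((n : ℝ) - 1) * ((n : ℝ) - 2) / 4 ∧
      (t : ℝ) - ((n : ℝ) - 1) * ((n : ℝ) - 2) / 4 ≤ 4 * Real.log n := by
  have hM : (Fintype.card (Edge n) : ℝ) = n * (n - 1) / 2 := by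
    rw [card_edge, Nat.cast_choose_two]
  have hn' : ((n - 1 : ℕ) : ℝ) = n - 1 := by
    rw [Nat.cast_sub (by omega), Nat.cast_one]
  have hn0 : (0 : ℝ) < n := by exact_mod_cast (by omega : 0 < n)
  have e1 : (Fintype.card (Edge n) : ℝ) + Nat.log 5 n + 2 ≤ 2 * t + (n - 1 : ℕ) := by
    exact_mod_cast h1
  have e2 : (2 : ℝ) * t + (n - 1 : ℕ) ≤ Fintype.card (Edge n) + Nat.log 2 n + 3 := by
    exact_mod_cast h2
  rw [hM, hn'] at e1 e2
  have hlog2 := Real.log_two_gt_d9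
  have hlogn : Real.log 2 ≤ Real.log n := Real.log_le_log (by norm_num) (by exact_mod_cast hn)
  have hlog5 : Real.log 5 ≤ 4 := by
    have := Real.log_le_sub_one_of_pos (show (0 : ℝ) < 5 by norm_num)
    linarith
  have l5 : Real.log n ≤ (Nat.log 5 n + 1) * 4 := by
    have h : (n : ℝ) ≤ 5 ^ (Nat.log 5 n + 1) := by
      exact_mod_cast (Nat.lt_pow_succ_log_self (by norm_num : 1 < 5) n).le
    have := Real.log_le_log hn0 h
    rw [Real.log_pow] at this
    push_cast at this
    nlinarith [(Nat.cast_nonneg (Nat.log 5 n) : (0 : ℝ) ≤ _)]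
  have l2 : (Nat.log 2 n : ℝ) * Real.log 2 ≤ Real.log n := by
    rw [← Real.log_pow]
    refine Real.log_le_log (by positivity) ?_
    exact_mod_cast Nat.pow_log_le_self 2 (by omega : n ≠ 0)
  constructor
  · linarith
  · nlinarith [(Nat.cast_nonneg (Nat.log 2 n) : (0 : ℝ) ≤ _)]

end AvoiderEnforcer

/-- Theorem 3:
`τ_E(D_n) = (1/2)·C(n-1,2) + Θ(log n)` and `τ_E(T_n) = (1/2)·C(n-1,2) + Θ(log n)`,
where `(1/2)·C(n-1,2) = (n-1)(n-2)/4`. -/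
theorem tauE_mindegree_connectivity_asymptotics :
    ∃ c₁ c₂ : ℝ, 0 < c₁ ∧ 0 < c₂ ∧ ∃ n₀ : ℕ, ∀ n : ℕ, n₀ ≤ n →
      (∃ t : ℕ, tauE n (Dfam n) = (t : ℕ∞) ∧
        c₁ * Real.log n ≤ (t : ℝ) - ((n : ℝ) - 1) * ((n : ℝ) - 2) / 4 ∧
        (t : ℝ) - ((n : ℝ) - 1) * ((n : ℝ) - 2) / 4 ≤ c₂ * Real.log n) ∧
      (∃ t : ℕ, tauE n (Tfam n) = (t : ℕ∞) ∧
        c₁ * Real.log n ≤ (t : ℝ) - ((n : ℝ) - 1) * ((n : ℝ) - 2) / 4 ∧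
        (t : ℝ) - ((n : ℝ) - 1) * ((n : ℝ) - 2) / 4 ≤ c₂ * Real.log n) := by
  refine ⟨1 / 8, 4, by norm_num, by norm_num, 8, fun n hn => ?_⟩
  have hn2 : 2 ≤ n := by omega
  have hlog : Nat.log 2 n + 3 ≤ n := by
    suffices Nat.log 2 n < n - 2 by omega
    refine Nat.log_lt_of_lt_pow (by omega) ?_
    induction n, hn using Nat.le_induction with
    | base => norm_num
    | succ k hk ih =>
      obtain ⟨j, rfl⟩ : ∃ j, k = j + 2 := ⟨k - 2, by omega⟩
      have := ih (by omega)
      simp only [Nat.add_sub_cancel, show j + 2 + 1 - 2 = j + 1 by omega, pow_succ] at this ⊢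
      omega
  obtain ⟨t, ht, hle⟩ := AvoiderEnforcer.exists_enforcerWinsBy hn2 hlog
  obtain ⟨d, hd, hd1, hd2⟩ :=
    AvoiderEnforcer.exists_tauE_eq (AvoiderEnforcer.enforcerWinsBy_dfam hn2 ht)
  obtain ⟨c, hc, hc1, hc2⟩ := AvoiderEnforcer.exists_tauE_eq ht
  have hd3 := AvoiderEnforcer.le_of_enforcerWinsBy hn2 hd1
  have hc3 := AvoiderEnforcer.le_of_enforcerWinsBy hn2 (AvoiderEnforcer.enforcerWinsBy_dfam hn2 hc1)
  exact ⟨⟨d, hd, AvoiderEnforcer.asymptotics_of_bounds hn2 hd3 (by omega)⟩,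
    ⟨c, hc, AvoiderEnforcer.asymptotics_of_bounds hn2 hc3 (by omega)⟩⟩
end
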